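/- Let n, m, ℓ₁, ℓ₂, d, δ_β, δ_B be positive integers and define L = 2·(3mδ_β) + 6(ℓ₁+ℓ₂)mδ_β + 3(n+m+ℓ₁)δ_B + 2ℓ₁ + 2ℓ₂ + 2d, the set VALID ⊆ {−1,0,1}^L, the index set S, and the permutations Γ_η of ℤ^L for η ∈ S as below. Then: (i) for every η ∈ S and every w ∈ ℤ^L, w ∈ VALID if and only if Γ_η(w) ∈ VALID; and (ii) for every fixed w ∈ VALID, the map η ↦ Γ_η(w) is a bijection from S onto VALID, so if η is chosen uniformly at random from S then Γ_η(w) is uniformly distributed on VALID. -/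

import Mathlib

/-! Generic versions of the encodings `enc₂`, `enc₃`, `Ext(mix(·,·))` and of the
permutations `φ_b`, `φ′_b`, `Ψ_{b,e}`, with blocks indexed by arbitrary
(finite) index types. Bits are elements of `{0,1} ⊆ ℤ` and trits elements of
`{-1,0,1} ⊆ ℤ`. -/

/-- `[a]₃`: the unique element of `{-1, 0, 1}` congruent to `a` modulo `3`. -/
def bal3 (a : ℤ) : ℤ := if a % 3 = 2 then -1 else a % 3

/-- The bit `[a]₂ ∈ {0,1}` congruent to `a` modulo `2`. -/
def bal2 (a : ℤ) : ℤ := a % 2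

/-- Slot of a block of three (labelled `-1, 0, 1` in order) corresponding to `[c]₃`. -/
def slot3 (c : ℤ) : Fin 3 := if bal3 c = -1 then 0 else if bal3 c = 0 then 1 else 2

/-- Slot of a block of two (labelled `0, 1` in order) corresponding to `[c]₂`. -/
def slot2 (c : ℤ) : Fin 2 := if bal2 c = 1 then 1 else 0

/-- `z` is a vector of bits. -/
def IsBit {α : Type*} (z : α → ℤ) : Prop := ∀ i, z i = 0 ∨ z i = 1

/-- `z` is a vector with entries in `{-1,0,1}`. -/
def IsTrit {α : Type*} (z : α → ℤ) : Prop := ∀ i, z i = -1 ∨ z i = 0 ∨ z i = 1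

/-- `enc₂(z)`: the block at `i` is `(z̄_i, z_i)`; the entry in slot `c ∈ {0,1}`
equals `1` iff `c = z_i`. -/
def enc2 {α : Type*} (z : α → ℤ) : α × Fin 2 → ℤ :=
  fun p => if ((p.2 : ℕ) : ℤ) = z p.1 then 1 else 0

/-- `φ_b`: the entry of `φ_b(v)` at slot `(i, c)` is `v_i^{([c + b_i]₂)}`. -/
def phi2 {α : Type*} (b : α → ℤ) (v : α × Fin 2 → ℤ) : α × Fin 2 → ℤ :=
  fun p => v (p.1, slot2 (((p.2 : ℕ) : ℤ) + b p.1))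

/-- `enc₃(z)`: the block at `i` is `([z_i+1]₃, [z_i]₃, [z_i−1]₃)`; the entry in the
slot labelled `c ∈ {-1,0,1}` equals `[z_i − c]₃`. -/
def enc3 {α : Type*} (z : α → ℤ) : α × Fin 3 → ℤ :=
  fun p => bal3 (z p.1 - (((p.2 : ℕ) : ℤ) - 1))

/-- `φ′_b`: the entry of `φ′_b(v)` at the slot labelled `c` is `v_i^{([c − b_i]₃)}`. -/
def phi3 {α : Type*} (b : α → ℤ) (v : α × Fin 3 → ℤ) : α × Fin 3 → ℤ :=
  fun p => v (p.1, slot3 ((((p.2 : ℕ) : ℤ) - 1) - b p.1))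

/-- `ext(t, z) ∈ ℤ^6`: entry at `(s, c)` is `[z − c]₃` if `s = t`, else `0`. -/
def ext (t z : ℤ) : Fin 2 × Fin 3 → ℤ :=
  fun p => if ((p.1 : ℕ) : ℤ) = t then bal3 (z - (((p.2 : ℕ) : ℤ) - 1)) else 0

/-- `ψ_{b,e}`: entry at `(s, c)` is `v^{([s+b]₂, [c−e]₃)}`. -/
def psi (b e : ℤ) (v : Fin 2 × Fin 3 → ℤ) : Fin 2 × Fin 3 → ℤ :=
  fun p => v (slot2 (((p.1 : ℕ) : ℤ) + b), slot3 ((((p.2 : ℕ) : ℤ) - 1) - e))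

/-- `Ext(mix(t, z))`: the `(i, j)`-block is `ext(t_i, z_j)`. -/
def ExtMix {α β : Type*} (t : α → ℤ) (z : β → ℤ) : α × β × Fin 2 × Fin 3 → ℤ :=
  fun p => ext (t p.1) (z p.2.1) p.2.2

/-- `Ψ_{b,e}` acting blockwise: the `(i, j)`-block of `Ψ_{b,e}(v)` is `ψ_{b_i,e_j}(v_{i,j})`. -/
def PsiMix {α β : Type*} (b : α → ℤ) (e : β → ℤ)
    (v : α × β × Fin 2 × Fin 3 → ℤ) : α × β × Fin 2 × Fin 3 → ℤ :=
  fun p => psi (b p.1) (e p.2.1) (fun q => v (p.1, p.2.1, q)) p.2.2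

/-- The index set of the extended witness `w ∈ ℤ^L`, partitioned into the seven
blocks `z_{1,1}, z_{1,2}, z_{1,3}, z_{1,4}, z_{1,5}, z_{2,1}, z_{2,2}` of sizes
`3mδ_β, 3mδ_β, 6(ℓ₁+ℓ₂)mδ_β, 3(n+m+ℓ₁)δ_B, 2ℓ₁, 2ℓ₂, 2d`. -/
abbrev Idx (n m ℓ₁ ℓ₂ d δβ δB : ℕ) : Type :=
  (Fin (m * δβ) × Fin 3) ⊕ (Fin (m * δβ) × Fin 3) ⊕
    ((Fin ℓ₁ ⊕ Fin ℓ₂) × Fin (m * δβ) × Fin 2 × Fin 3) ⊕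
    (Fin ((n + m + ℓ₁) * δB) × Fin 3) ⊕
    (Fin ℓ₁ × Fin 2) ⊕ (Fin ℓ₂ × Fin 2) ⊕ (Fin d × Fin 2)

/-- The set `VALID`: vectors `w = (z_{1,1} ‖ z_{1,2} ‖ z_{1,3} ‖ z_{1,4} ‖ z_{1,5} ‖
z_{2,1} ‖ z_{2,2})` for which there exist `y_{v,1}, y_{v,2} ∈ {-1,0,1}^{mδ_β}`,
`y_id ∈ {0,1}^{ℓ₁}`, `y_p ∈ {0,1}^{ℓ₂}`, `y_{1,4} ∈ {-1,0,1}^{(n+m+ℓ₁)δ_B}`,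
`y_q ∈ {0,1}^d` with `z_{1,1} = enc₃(y_{v,1})`, `z_{1,2} = enc₃(y_{v,2})`,
`z_{1,3} = Ext(mix(y_id ‖ y_p, y_{v,2}))`, `z_{1,4} = enc₃(y_{1,4})`,
`z_{1,5} = enc₂(y_id)`, `z_{2,1} = enc₂(y_p)`, `z_{2,2} = enc₂(y_q)`. -/
def VALID (n m ℓ₁ ℓ₂ d δβ δB : ℕ) : Set (Idx n m ℓ₁ ℓ₂ d δβ δB → ℤ) :=
  {w | ∃ (yv1 yv2 : Fin (m * δβ) → ℤ) (yid : Fin ℓ₁ → ℤ) (yp : Fin ℓ₂ → ℤ)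
        (y14 : Fin ((n + m + ℓ₁) * δB) → ℤ) (yq : Fin d → ℤ),
      IsTrit yv1 ∧ IsTrit yv2 ∧ IsBit yid ∧ IsBit yp ∧ IsTrit y14 ∧ IsBit yq ∧
      (fun p => w (Sum.inl p)) = enc3 yv1 ∧
      (fun p => w (Sum.inr (Sum.inl p))) = enc3 yv2 ∧
      (fun p => w (Sum.inr (Sum.inr (Sum.inl p)))) = ExtMix (Sum.elim yid yp) yv2 ∧
      (fun p => w (Sum.inr (Sum.inr (Sum.inr (Sum.inl p))))) = enc3 y14 ∧
      (fun p => w (Sum.inr (Sum.inr (Sum.inr (Sum.inr (Sum.inl p)))))) = enc2 yid ∧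
      (fun p => w (Sum.inr (Sum.inr (Sum.inr (Sum.inr (Sum.inr (Sum.inl p))))))) = enc2 yp ∧
      (fun p => w (Sum.inr (Sum.inr (Sum.inr (Sum.inr (Sum.inr (Sum.inr p))))))) = enc2 yq}

/-- The type of tuples `η = (b_{v,1}, b_{v,2}, b_{1,4}, b_id, b_p, b_q)`. -/
abbrev Eta (n m ℓ₁ ℓ₂ d δβ δB : ℕ) : Type :=
  (Fin (m * δβ) → ℤ) × (Fin (m * δβ) → ℤ) × (Fin ((n + m + ℓ₁) * δB) → ℤ) ×
    (Fin ℓ₁ → ℤ) × (Fin ℓ₂ → ℤ) × (Fin d → ℤ)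

/-- The index set `S = ({-1,0,1}^{mδ_β})² × {-1,0,1}^{(n+m+ℓ₁)δ_B} × {0,1}^{ℓ₁} ×
{0,1}^{ℓ₂} × {0,1}^d`. -/
def Sset (n m ℓ₁ ℓ₂ d δβ δB : ℕ) : Set (Eta n m ℓ₁ ℓ₂ d δβ δB) :=
  {η | IsTrit η.1 ∧ IsTrit η.2.1 ∧ IsTrit η.2.2.1 ∧
    IsBit η.2.2.2.1 ∧ IsBit η.2.2.2.2.1 ∧ IsBit η.2.2.2.2.2}

/-- The permutation `Γ_η` of `ℤ^L`, for `η = (b_{v,1}, b_{v,2}, b_{1,4}, b_id, b_p, b_q)`: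
`Γ_η(z) = (φ′_{b_{v,1}}(z_{1,1}) ‖ φ′_{b_{v,2}}(z_{1,2}) ‖ Ψ_{b_id‖b_p, b_{v,2}}(z_{1,3}) ‖
φ′_{b_{1,4}}(z_{1,4}) ‖ φ_{b_id}(z_{1,5}) ‖ φ_{b_p}(z_{2,1}) ‖ φ_{b_q}(z_{2,2}))`. -/
def Gamma {n m ℓ₁ ℓ₂ d δβ δB : ℕ} (η : Eta n m ℓ₁ ℓ₂ d δβ δB)
    (w : Idx n m ℓ₁ ℓ₂ d δβ δB → ℤ) : Idx n m ℓ₁ ℓ₂ d δβ δB → ℤ :=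
  fun i =>
    match i with
    | Sum.inl p => phi3 η.1 (fun p' => w (Sum.inl p')) p
    | Sum.inr (Sum.inl p) => phi3 η.2.1 (fun p' => w (Sum.inr (Sum.inl p'))) p
    | Sum.inr (Sum.inr (Sum.inl p)) =>
        PsiMix (Sum.elim η.2.2.2.1 η.2.2.2.2.1) η.2.1
          (fun p' => w (Sum.inr (Sum.inr (Sum.inl p')))) p
    | Sum.inr (Sum.inr (Sum.inr (Sum.inl p))) =>
        phi3 η.2.2.1 (fun p' => w (Sum.inr (Sum.inr (Sum.inr (Sum.inl p'))))) p
    | Sum.inr (Sum.inr (Sum.inr (Sum.inr (Sum.inl p)))) =>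
        phi2 η.2.2.2.1
          (fun p' => w (Sum.inr (Sum.inr (Sum.inr (Sum.inr (Sum.inl p')))))) p
    | Sum.inr (Sum.inr (Sum.inr (Sum.inr (Sum.inr (Sum.inl p))))) =>
        phi2 η.2.2.2.2.1
          (fun p' => w (Sum.inr (Sum.inr (Sum.inr (Sum.inr (Sum.inr (Sum.inl p'))))))) p
    | Sum.inr (Sum.inr (Sum.inr (Sum.inr (Sum.inr (Sum.inr p))))) =>
        phi2 η.2.2.2.2.2
          (fun p' => w (Sum.inr (Sum.inr (Sum.inr (Sum.inr (Sum.inr (Sum.inr p'))))))) p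

/-- The vector with entries `[z_i + b_i]₃`. -/
def addTrit {α : Type*} (b z : α → ℤ) : α → ℤ := fun i => bal3 (z i + b i)

/-- The vector with entries `[z_i + b_i]₂`. -/
def addBit {α : Type*} (b z : α → ℤ) : α → ℤ := fun i => bal2 (z i + b i)

theorem bal3_eq_self {a : ℤ} (ha : a = -1 ∨ a = 0 ∨ a = 1) : bal3 a = a := by
  rcases ha with rfl | rfl | rfl <;> rfl

theorem bal2_eq_self {a : ℤ} (ha : a = 0 ∨ a = 1) : bal2 a = a := by
  rcases ha with rfl | rfl <;> rfl

theorem bal3_eq_iff {a b : ℤ} : bal3 a = bal3 b ↔ a % 3 = b % 3 := by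
  unfold bal3; split_ifs <;> omega

theorem bal2_eq_iff {a b : ℤ} : bal2 a = bal2 b ↔ a % 2 = b % 2 := Iff.rfl

theorem bal3_emod (a : ℤ) : bal3 a % 3 = a % 3 := by
  unfold bal3; split_ifs <;> omega

theorem bal2_emod (a : ℤ) : bal2 a % 2 = a % 2 := by
  unfold bal2; omega

theorem slot3_val (c : ℤ) : (((slot3 c : Fin 3) : ℕ) : ℤ) - 1 = bal3 c := by
  unfold slot3
  split_ifs with h h'
  · simp [h]
  · simp [h']
  · unfold bal3 at *
    split_ifs at * <;> simp <;> omega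

theorem slot2_val (c : ℤ) : (((slot2 c : Fin 2) : ℕ) : ℤ) = bal2 c := by
  unfold slot2
  split_ifs with h
  · simp [h]
  · unfold bal2 at *
    simp
    omega

theorem slot3_eq {c : ℤ} {k : Fin 3} (h : c % 3 = (((k : ℕ) : ℤ) - 1) % 3) : slot3 c = k := by
  have h₁ := slot3_val c
  have h₂ := bal3_emod c
  omega

theorem slot2_eq {c : ℤ} {k : Fin 2} (h : c % 2 = ((k : ℕ) : ℤ) % 2) : slot2 c = k := by
  have h₁ := slot2_val c
  have h₂ := bal2_emod c
  omega

section Encodings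

variable {α β : Type*}

theorem isTrit_addTrit (b z : α → ℤ) : IsTrit (addTrit b z) := by
  intro i
  simp only [addTrit, bal3]
  split_ifs <;> omega

theorem isBit_addBit (b z : α → ℤ) : IsBit (addBit b z) := by
  intro i
  simp only [addBit, bal2]
  omega

theorem addTrit_left_injective {b b' z : α → ℤ} (hb : IsTrit b) (hb' : IsTrit b')
    (h : addTrit b z = addTrit b' z) : b = b' := by
  funext i
  have h₁ := bal3_eq_iff.1 (congrFun h i)
  have h₂ := hb i
  have h₃ := hb' i
  omega

theorem addBit_left_injective {b b' z : α → ℤ} (hb : IsBit b) (hb' : IsBit b')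
    (h : addBit b z = addBit b' z) : b = b' := by
  funext i
  have h₁ := bal2_eq_iff.1 (congrFun h i)
  have h₂ := hb i
  have h₃ := hb' i
  omega

theorem addTrit_addTrit_neg {y z : α → ℤ} (hz : IsTrit z) :
    addTrit (addTrit (-y) z) y = z := by
  funext i
  refine Eq.trans (bal3_eq_iff.2 ?_) (bal3_eq_self (hz i))
  have h := bal3_emod (z i + -y i)
  simp only [addTrit, Pi.neg_apply]
  omega

theorem addBit_addBit_neg {y z : α → ℤ} (hz : IsBit z) :
    addBit (addBit (-y) z) y = z := by
  funext i
  refine Eq.trans (bal2_eq_iff.2 ?_) (bal2_eq_self (hz i))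
  have h := bal2_emod (z i + -y i)
  simp only [addBit, Pi.neg_apply]
  omega

theorem enc3_injective {y z : α → ℤ} (hy : IsTrit y) (hz : IsTrit z)
    (h : enc3 y = enc3 z) : y = z := by
  funext i
  have h₁ : bal3 (y i - (((1 : ℕ) : ℤ) - 1)) = bal3 (z i - (((1 : ℕ) : ℤ) - 1)) :=
    congrFun h (i, 1)
  have h₂ := bal3_eq_iff.1 h₁
  have h₃ := hy i
  have h₄ := hz i
  omega

theorem enc2_injective {y z : α → ℤ} (hy : IsBit y) (hz : IsBit z)
    (h : enc2 y = enc2 z) : y = z := by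
  funext i
  have h₁ : (if ((1 : ℕ) : ℤ) = y i then (1 : ℤ) else 0) =
      if ((1 : ℕ) : ℤ) = z i then 1 else 0 := congrFun h (i, 1)
  have h₃ := hy i
  have h₄ := hz i
  split_ifs at h₁ <;> omega

theorem bal3_sub_slot3 (z b c : ℤ) :
    bal3 (z - ((((slot3 (c - b) : Fin 3) : ℕ) : ℤ) - 1)) = bal3 (bal3 (z + b) - c) := by
  rw [slot3_val, bal3_eq_iff]
  have h₁ := bal3_emod (c - b)
  have h₂ := bal3_emod (z + b)
  omega

theorem slot2_eq_iff {z : ℤ} (hz : z = 0 ∨ z = 1) (b : ℤ) (s : Fin 2) :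
    (((slot2 (((s : ℕ) : ℤ) + b) : Fin 2) : ℕ) : ℤ) = z ↔ ((s : ℕ) : ℤ) = bal2 (z + b) := by
  rw [slot2_val]
  unfold bal2
  omega

theorem phi3_enc3 (b z : α → ℤ) : phi3 b (enc3 z) = enc3 (addTrit b z) := by
  funext p
  exact bal3_sub_slot3 _ _ _

theorem phi2_enc2 (b : α → ℤ) {z : α → ℤ} (hz : IsBit z) :
    phi2 b (enc2 z) = enc2 (addBit b z) := by
  funext p
  exact if_congr (slot2_eq_iff (hz _) _ _) rfl rfl

theorem PsiMix_ExtMix (b : α → ℤ) (e : β → ℤ) {t : α → ℤ} (ht : IsBit t) (z : β → ℤ) :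
    PsiMix b e (ExtMix t z) = ExtMix (addBit b t) (addTrit e z) := by
  funext p
  exact if_congr (slot2_eq_iff (ht _) _ _) (bal3_sub_slot3 _ _ _) rfl

theorem slot3_neg_cancel (b : ℤ) (k : Fin 3) :
    slot3 ((((slot3 ((((k : ℕ) : ℤ) - 1) - -b) : Fin 3) : ℕ) : ℤ) - 1 - b) = k := by
  apply slot3_eq
  rw [slot3_val]
  have h := bal3_emod ((((k : ℕ) : ℤ) - 1) - -b)
  omega

theorem slot2_neg_cancel (b : ℤ) (k : Fin 2) :
    slot2 ((((slot2 (((k : ℕ) : ℤ) + -b) : Fin 2) : ℕ) : ℤ) + b) = k := by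
  apply slot2_eq
  rw [slot2_val]
  have h := bal2_emod (((k : ℕ) : ℤ) + -b)
  omega

theorem phi3_neg_phi3 (b : α → ℤ) (v : α × Fin 3 → ℤ) : phi3 (-b) (phi3 b v) = v := by
  funext p
  simp only [phi3, Pi.neg_apply, slot3_neg_cancel]

theorem phi2_neg_phi2 (b : α → ℤ) (v : α × Fin 2 → ℤ) : phi2 (-b) (phi2 b v) = v := by
  funext p
  simp only [phi2, Pi.neg_apply, slot2_neg_cancel]

theorem PsiMix_neg_PsiMix (b : α → ℤ) (e : β → ℤ) (v : α × β × Fin 2 × Fin 3 → ℤ) :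
    PsiMix (-b) (-e) (PsiMix b e v) = v := by
  funext p
  simp only [PsiMix, psi, Pi.neg_apply, slot3_neg_cancel, slot2_neg_cancel]

theorem isBit_sumElim {s : α → ℤ} {t : β → ℤ} (hs : IsBit s) (ht : IsBit t) :
    IsBit (Sum.elim s t) := by
  rintro (i | i)
  exacts [hs i, ht i]

theorem addBit_sumElim (b s : α → ℤ) (c t : β → ℤ) :
    addBit (Sum.elim b c) (Sum.elim s t) = Sum.elim (addBit b s) (addBit c t) := by
  funext i
  cases i <;> rfl

end Encodings

section Witness

variable {n m ℓ₁ ℓ₂ d δβ δB : ℕ}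

/-- The extended witness encoding the tuple `y = (y_{v,1}, y_{v,2}, y_{1,4}, y_id, y_p, y_q)`. -/
def encode (y : Eta n m ℓ₁ ℓ₂ d δβ δB) : Idx n m ℓ₁ ℓ₂ d δβ δB → ℤ :=
  Sum.elim (enc3 y.1) <| Sum.elim (enc3 y.2.1) <|
    Sum.elim (ExtMix (Sum.elim y.2.2.2.1 y.2.2.2.2.1) y.2.1) <|
      Sum.elim (enc3 y.2.2.1) <| Sum.elim (enc2 y.2.2.2.1) <|
        Sum.elim (enc2 y.2.2.2.2.1) (enc2 y.2.2.2.2.2)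

/-- Blockwise addition, modulo `3` on the trit blocks and modulo `2` on the bit blocks. -/
def addEta (η y : Eta n m ℓ₁ ℓ₂ d δβ δB) : Eta n m ℓ₁ ℓ₂ d δβ δB :=
  (addTrit η.1 y.1, addTrit η.2.1 y.2.1, addTrit η.2.2.1 y.2.2.1,
    addBit η.2.2.2.1 y.2.2.2.1, addBit η.2.2.2.2.1 y.2.2.2.2.1,
    addBit η.2.2.2.2.2 y.2.2.2.2.2)

theorem addEta_mem_Sset (η y : Eta n m ℓ₁ ℓ₂ d δβ δB) :
    addEta η y ∈ Sset n m ℓ₁ ℓ₂ d δβ δB :=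
  ⟨isTrit_addTrit _ _, isTrit_addTrit _ _, isTrit_addTrit _ _,
    isBit_addBit _ _, isBit_addBit _ _, isBit_addBit _ _⟩

theorem addEta_left_injective {η η' y : Eta n m ℓ₁ ℓ₂ d δβ δB}
    (hη : η ∈ Sset n m ℓ₁ ℓ₂ d δβ δB) (hη' : η' ∈ Sset n m ℓ₁ ℓ₂ d δβ δB)
    (h : addEta η y = addEta η' y) : η = η' := by
  obtain ⟨h₁, h₂, h₃, h₄, h₅, h₆⟩ := hη
  obtain ⟨k₁, k₂, k₃, k₄, k₅, k₆⟩ := hη'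
  simp only [addEta, Prod.mk.injEq] at h
  obtain ⟨e₁, e₂, e₃, e₄, e₅, e₆⟩ := h
  exact Prod.ext (addTrit_left_injective h₁ k₁ e₁) <|
    Prod.ext (addTrit_left_injective h₂ k₂ e₂) <|
    Prod.ext (addTrit_left_injective h₃ k₃ e₃) <|
    Prod.ext (addBit_left_injective h₄ k₄ e₄) <|
    Prod.ext (addBit_left_injective h₅ k₅ e₅) (addBit_left_injective h₆ k₆ e₆)

theorem addEta_addEta_neg (y : Eta n m ℓ₁ ℓ₂ d δβ δB) {z : Eta n m ℓ₁ ℓ₂ d δβ δB}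
    (hz : z ∈ Sset n m ℓ₁ ℓ₂ d δβ δB) : addEta (addEta (-y) z) y = z := by
  obtain ⟨h₁, h₂, h₃, h₄, h₅, h₆⟩ := hz
  exact Prod.ext (addTrit_addTrit_neg h₁) <| Prod.ext (addTrit_addTrit_neg h₂) <|
    Prod.ext (addTrit_addTrit_neg h₃) <| Prod.ext (addBit_addBit_neg h₄) <|
    Prod.ext (addBit_addBit_neg h₅) (addBit_addBit_neg h₆)

theorem mem_VALID_iff {w : Idx n m ℓ₁ ℓ₂ d δβ δB → ℤ} :
    w ∈ VALID n m ℓ₁ ℓ₂ d δβ δB ↔ ∃ y ∈ Sset n m ℓ₁ ℓ₂ d δβ δB, encode y = w := by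
  constructor
  · rintro ⟨yv1, yv2, yid, yp, y14, yq, h₁, h₂, h₃, h₄, h₅, h₆, e₁, e₂, e₃, e₄, e₅, e₆, e₇⟩
    refine ⟨(yv1, yv2, y14, yid, yp, yq), ⟨h₁, h₂, h₅, h₃, h₄, h₆⟩, ?_⟩
    funext i
    rcases i with p | p | p | p | p | p | p
    exacts [(congrFun e₁ p).symm, (congrFun e₂ p).symm, (congrFun e₃ p).symm,
      (congrFun e₄ p).symm, (congrFun e₅ p).symm, (congrFun e₆ p).symm, (congrFun e₇ p).symm]
  · rintro ⟨y, ⟨h₁, h₂, h₃, h₄, h₅, h₆⟩, rfl⟩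
    exact ⟨_, _, _, _, _, _, h₁, h₂, h₄, h₅, h₃, h₆, rfl, rfl, rfl, rfl, rfl, rfl, rfl⟩

theorem encode_injOn :
    Set.InjOn (encode (n := n) (m := m) (ℓ₁ := ℓ₁) (ℓ₂ := ℓ₂) (d := d) (δβ := δβ) (δB := δB))
      (Sset n m ℓ₁ ℓ₂ d δβ δB) := by
  rintro y ⟨h₁, h₂, h₃, h₄, h₅, h₆⟩ z ⟨k₁, k₂, k₃, k₄, k₅, k₆⟩ h
  simp only [encode, Sum.elim_eq_iff] at h
  obtain ⟨e₁, e₂, -, e₃, e₄, e₅, e₆⟩ := h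
  exact Prod.ext (enc3_injective h₁ k₁ e₁) <| Prod.ext (enc3_injective h₂ k₂ e₂) <|
    Prod.ext (enc3_injective h₃ k₃ e₃) <| Prod.ext (enc2_injective h₄ k₄ e₄) <|
    Prod.ext (enc2_injective h₅ k₅ e₅) (enc2_injective h₆ k₆ e₆)

theorem Gamma_encode (η : Eta n m ℓ₁ ℓ₂ d δβ δB) {y : Eta n m ℓ₁ ℓ₂ d δβ δB}
    (hy : y ∈ Sset n m ℓ₁ ℓ₂ d δβ δB) : Gamma η (encode y) = encode (addEta η y) := by
  obtain ⟨-, -, -, h₄, h₅, h₆⟩ := hy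
  have hmix := PsiMix_ExtMix (Sum.elim η.2.2.2.1 η.2.2.2.2.1) η.2.1
    (isBit_sumElim h₄ h₅) y.2.1
  rw [addBit_sumElim] at hmix
  funext i
  rcases i with p | p | p | p | p | p | p
  exacts [congrFun (phi3_enc3 _ _) p, congrFun (phi3_enc3 _ _) p, congrFun hmix p,
    congrFun (phi3_enc3 _ _) p, congrFun (phi2_enc2 _ h₄) p, congrFun (phi2_enc2 _ h₅) p,
    congrFun (phi2_enc2 _ h₆) p]

theorem Gamma_neg_Gamma (η : Eta n m ℓ₁ ℓ₂ d δβ δB) (w : Idx n m ℓ₁ ℓ₂ d δβ δB → ℤ) :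
    Gamma (-η) (Gamma η w) = w := by
  have hneg : Sum.elim (-η.2.2.2.1) (-η.2.2.2.2.1) = -Sum.elim η.2.2.2.1 η.2.2.2.2.1 := by
    funext i
    cases i <;> rfl
  have hmix := PsiMix_neg_PsiMix (Sum.elim η.2.2.2.1 η.2.2.2.2.1) η.2.1
    (fun p => w (Sum.inr (Sum.inr (Sum.inl p))))
  rw [← hneg] at hmix
  funext i
  rcases i with p | p | p | p | p | p | p
  exacts [congrFun (phi3_neg_phi3 η.1 fun p => w (Sum.inl p)) p,
    congrFun (phi3_neg_phi3 η.2.1 fun p => w (Sum.inr (Sum.inl p))) p,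
    congrFun hmix p,
    congrFun (phi3_neg_phi3 η.2.2.1
      fun p => w (Sum.inr (Sum.inr (Sum.inr (Sum.inl p))))) p,
    congrFun (phi2_neg_phi2 η.2.2.2.1
      fun p => w (Sum.inr (Sum.inr (Sum.inr (Sum.inr (Sum.inl p)))))) p,
    congrFun (phi2_neg_phi2 η.2.2.2.2.1
      fun p => w (Sum.inr (Sum.inr (Sum.inr (Sum.inr (Sum.inr (Sum.inl p))))))) p,
    congrFun (phi2_neg_phi2 η.2.2.2.2.2
      fun p => w (Sum.inr (Sum.inr (Sum.inr (Sum.inr (Sum.inr (Sum.inr p))))))) p]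

theorem Gamma_mem_VALID (η : Eta n m ℓ₁ ℓ₂ d δβ δB) {w : Idx n m ℓ₁ ℓ₂ d δβ δB → ℤ}
    (hw : w ∈ VALID n m ℓ₁ ℓ₂ d δβ δB) : Gamma η w ∈ VALID n m ℓ₁ ℓ₂ d δβ δB := by
  obtain ⟨y, hy, rfl⟩ := mem_VALID_iff.1 hw
  exact mem_VALID_iff.2 ⟨_, addEta_mem_Sset η y, (Gamma_encode η hy).symm⟩

end Witness

/-- The index type has exactly `L` elements, `(i)` each `Γ_η` with `η ∈ S` preserves
and reflects membership in `VALID`, and `(ii)` for every fixed `w ∈ VALID` the map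
`η ↦ Γ_η(w)` is a bijection from `S` onto `VALID` (so `Γ_η(w)` is uniform on `VALID`
for `η` uniform on `S`). -/
theorem Gamma_valid_equiv_and_bijOn (n m ℓ₁ ℓ₂ d δβ δB : ℕ)
    (hn : 0 < n) (hm : 0 < m) (hℓ₁ : 0 < ℓ₁) (hℓ₂ : 0 < ℓ₂) (hd : 0 < d)
    (hδβ : 0 < δβ) (hδB : 0 < δB) :
    Fintype.card (Idx n m ℓ₁ ℓ₂ d δβ δB) =
        2 * (3 * m * δβ) + 6 * (ℓ₁ + ℓ₂) * m * δβ + 3 * (n + m + ℓ₁) * δB +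
          2 * ℓ₁ + 2 * ℓ₂ + 2 * d ∧
    (∀ η ∈ Sset n m ℓ₁ ℓ₂ d δβ δB, ∀ w : Idx n m ℓ₁ ℓ₂ d δβ δB → ℤ,
      w ∈ VALID n m ℓ₁ ℓ₂ d δβ δB ↔ Gamma η w ∈ VALID n m ℓ₁ ℓ₂ d δβ δB) ∧
    ∀ w ∈ VALID n m ℓ₁ ℓ₂ d δβ δB,
      Set.BijOn (fun η => Gamma η w) (Sset n m ℓ₁ ℓ₂ d δβ δB)
        (VALID n m ℓ₁ ℓ₂ d δβ δB) := by
  refine ⟨?_, fun η _ w => ⟨Gamma_mem_VALID η, fun h => ?_⟩, fun w hw =>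
    ⟨fun η _ => Gamma_mem_VALID η hw, ?_, ?_⟩⟩
  · simp only [Fintype.card_sum, Fintype.card_prod, Fintype.card_fin]
    ring
  · rw [← Gamma_neg_Gamma η w]
    exact Gamma_mem_VALID (-η) h
  · obtain ⟨y, hy, rfl⟩ := mem_VALID_iff.1 hw
    intro η hη η' hη' h
    simp only [Gamma_encode _ hy] at h
    exact addEta_left_injective hη hη'
      (encode_injOn (addEta_mem_Sset _ _) (addEta_mem_Sset _ _) h)
  · obtain ⟨y, hy, rfl⟩ := mem_VALID_iff.1 hw
    intro w' hw'
    obtain ⟨z, hz, rfl⟩ := mem_VALID_iff.1 hw'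
    refine ⟨addEta (-y) z, addEta_mem_Sset _ _, ?_⟩
    simp only [Gamma_encode _ hy, addEta_addEta_neg y hz]
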